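/- Let X be a normal topological space and let S, S₁, S₂, S₃ ⊆ X be nonempty closed subsets with S₁, S₂, S₃ pairwise disjoint. Suppose given functionals ζ⁺, ζ⁻ : C(X, ℝ) → ℝ and, for each j ∈ {1,2,3}, functionals ζⱼ⁺, ζⱼ⁻ : C(X, ℝ) → ℝ, such that: S is both ζ⁺- and ζ⁻-superheavy-and-heavy; each Sⱼ is both ζⱼ⁺- and ζⱼ⁻-superheavy-and-heavy; and for each j ∈ {1,2,3} the pairs share an element, i.e., ζ⁺ = ζⱼ⁺ or ζ⁺ = ζⱼ⁻ or ζ⁻ = ζⱼ⁺ or ζ⁻ = ζⱼ⁻. Then a contradiction follows (such a configuration cannot exist). -/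

import Mathlib

/-- A subset `S` is `ζ`-superheavy-and-heavy if for every continuous `H : X → ℝ` and reals
`a`, `b`: a lower bound of `H` on `S` bounds `ζ H` from below, and an upper bound of `H`
on `S` bounds `ζ H` from above. -/
def SuperheavyHeavy {X : Type*} [TopologicalSpace X] (ζ : C(X, ℝ) → ℝ) (S : Set X) : Prop :=
  ∀ (H : C(X, ℝ)) (a b : ℝ),
    ((∀ x ∈ S, a ≤ H x) → a ≤ ζ H) ∧ ((∀ x ∈ S, H x ≤ b) → ζ H ≤ b)

/-- Disjoint closed subsets of a normal space are not both superheavy for the same functional. -/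
theorem SuperheavyHeavy.not_disjoint {X : Type*} [TopologicalSpace X] [NormalSpace X]
    {ζ : C(X, ℝ) → ℝ} {S T : Set X} (hS : SuperheavyHeavy ζ S) (hT : SuperheavyHeavy ζ T)
    (hSc : IsClosed S) (hTc : IsClosed T) : ¬ Disjoint S T := by
  intro hd
  obtain ⟨f, hf0, hf1, -⟩ := exists_continuous_zero_one_of_isClosed hSc hTc hd
  have hle : ζ f ≤ 0 := (hS f 0 0).2 fun x hx => (hf0 hx).le
  have hge : 1 ≤ ζ f := (hT f 1 1).1 fun x hx => (hf1 hx).ge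
  linarith

/-- If two pairs of functionals share an element and `S` is superheavy for the second pair, then
`S` is superheavy for some element of the first pair. -/
theorem SuperheavyHeavy.or_of_shared {X : Type*} [TopologicalSpace X]
    {ζp ζm ξp ξm : C(X, ℝ) → ℝ} {S : Set X}
    (hp : SuperheavyHeavy ξp S) (hm : SuperheavyHeavy ξm S)
    (hshare : ζp = ξp ∨ ζp = ξm ∨ ζm = ξp ∨ ζm = ξm) :
    SuperheavyHeavy ζp S ∨ SuperheavyHeavy ζm S := by
  rcases hshare with rfl | rfl | rfl | rfl <;> simp [*]

/-- The D₄-configuration pattern cannot exist: if `S` is superheavy for `ζ⁺, ζ⁻`, each of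
three pairwise disjoint nonempty closed sets `S₁, S₂, S₃` is superheavy for its own pair of
functionals, and each pair shares an element with `{ζ⁺, ζ⁻}`, then a contradiction follows. -/
theorem no_D4_configuration {X : Type*} [TopologicalSpace X] [NormalSpace X]
    (S S₁ S₂ S₃ : Set X)
    (hS : S.Nonempty) (hS₁ : S₁.Nonempty) (hS₂ : S₂.Nonempty) (hS₃ : S₃.Nonempty)
    (hSc : IsClosed S) (hS₁c : IsClosed S₁) (hS₂c : IsClosed S₂) (hS₃c : IsClosed S₃)
    (h12 : S₁ ∩ S₂ = ∅) (h13 : S₁ ∩ S₃ = ∅) (h23 : S₂ ∩ S₃ = ∅)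
    (ζp ζm ζ₁p ζ₁m ζ₂p ζ₂m ζ₃p ζ₃m : C(X, ℝ) → ℝ)
    (hSp : SuperheavyHeavy ζp S) (hSm : SuperheavyHeavy ζm S)
    (h1p : SuperheavyHeavy ζ₁p S₁) (h1m : SuperheavyHeavy ζ₁m S₁)
    (h2p : SuperheavyHeavy ζ₂p S₂) (h2m : SuperheavyHeavy ζ₂m S₂)
    (h3p : SuperheavyHeavy ζ₃p S₃) (h3m : SuperheavyHeavy ζ₃m S₃)
    (hshare1 : ζp = ζ₁p ∨ ζp = ζ₁m ∨ ζm = ζ₁p ∨ ζm = ζ₁m)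
    (hshare2 : ζp = ζ₂p ∨ ζp = ζ₂m ∨ ζm = ζ₂p ∨ ζm = ζ₂m)
    (hshare3 : ζp = ζ₃p ∨ ζp = ζ₃m ∨ ζm = ζ₃p ∨ ζm = ζ₃m) : False := by
  rw [← Set.disjoint_iff_inter_eq_empty] at h12 h13 h23
  rcases h1p.or_of_shared h1m hshare1 with k1 | k1 <;>
  rcases h2p.or_of_shared h2m hshare2 with k2 | k2 <;>
  rcases h3p.or_of_shared h3m hshare3 with k3 | k3 <;>
  first
  | exact k1.not_disjoint k2 hS₁c hS₂c h12
  | exact k1.not_disjoint k3 hS₁c hS₃c h13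
  | exact k2.not_disjoint k3 hS₂c hS₃c h23
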